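/- Let H₁ be an n_r × n_s complex matrix, H₂ an n_d × n_r complex matrix, a ≥ 0 real, and suppose H₂ᴴ·H₂ = c·I for some real c > 0. Then the largest eigenvalue of A = H₁ᴴ·H₂ᴴ·(a·H₂·H₂ᴴ + I)⁻¹·H₂·H₁ satisfies λ_max(A) = (c/(a·c + 1))·λ_max(H₁ᴴ·H₁). (This is the deterministic content of the large-n_d case of Theorem 7: when H₂ᴴ·H₂/n_d = I, λ_max = (n_d/(a·n_d + 1))·λ_max(H₁ᴴ·H₁).) -/

import Mathlib

open Matrix

open scoped ComplexOrder in
lemma Matrix.isUnit_det_smul_mul_conjTranspose_add_one {m n : Type*} [Fintype m] [DecidableEq m]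
    [Fintype n] (B : Matrix m n ℂ) {a : ℝ} (ha : 0 ≤ a) :
    IsUnit ((a : ℂ) • (B * Bᴴ) + 1).det := by
  have h : ((a : ℂ) • (B * Bᴴ)).PosSemidef :=
    (posSemidef_self_mul_conjTranspose B).smul (by exact_mod_cast ha)
  exact (isUnit_iff_isUnit_det _).mp (PosDef.posSemidef_add h PosDef.one).isUnit

lemma Matrix.conjTranspose_mul_inv_mul_of_conjTranspose_mul_self {m n : Type*} [Fintype m]
    [DecidableEq m] [Fintype n] [DecidableEq n] (B : Matrix m n ℂ) {a c : ℝ} (ha : 0 ≤ a)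
    (hc : 0 < c) (hB : Bᴴ * B = (c : ℂ) • 1) :
    Bᴴ * ((a : ℂ) • (B * Bᴴ) + 1)⁻¹ * B = ((c / (a * c + 1) : ℝ) : ℂ) • 1 := by
  set M := (a : ℂ) • (B * Bᴴ) + 1 with hM
  have hu : IsUnit M.det := isUnit_det_smul_mul_conjTranspose_add_one B ha
  have hne : ((a * c + 1 : ℝ) : ℂ) ≠ 0 := by
    have : 0 < a * c + 1 := by positivity
    exact_mod_cast this.ne'
  have hMB : M * B = ((a * c + 1 : ℝ) : ℂ) • B := by
    rw [hM, Matrix.add_mul, Matrix.smul_mul, Matrix.mul_assoc, hB, Matrix.mul_smul,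
      Matrix.mul_one, Matrix.one_mul, smul_smul]
    push_cast
    rw [add_smul, one_smul]
  have hinv : M⁻¹ * B = ((a * c + 1 : ℝ) : ℂ)⁻¹ • B := by
    rw [eq_inv_smul_iff₀ hne, ← Matrix.mul_smul, ← hMB, nonsing_inv_mul_cancel_left _ _ hu]
  rw [Matrix.mul_assoc, hinv, Matrix.mul_smul, hB, smul_smul, Complex.ofReal_div, div_eq_inv_mul]

lemma Matrix.IsHermitian.iSup_eigenvalues_eq_sSup_spectrum {n : Type*} [Fintype n] [DecidableEq n]
    {A : Matrix n n ℂ} (hA : A.IsHermitian) : ⨆ i, hA.eigenvalues i = sSup (spectrum ℝ A) := by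
  rw [hA.spectrum_real_eq_range_eigenvalues, sSup_range]

open scoped Pointwise in
lemma spectrum.sSup_smul_of_pos {R : Type*} [Ring R] [Algebra ℝ R] (x : R) {k : ℝ} (hk : 0 < k) :
    sSup (spectrum ℝ (k • x)) = k * sSup (spectrum ℝ x) := by
  rw [← Units.smul_mk0 hk.ne', spectrum.unit_smul_eq_smul, Units.smul_mk0,
    Real.sSup_smul_of_nonneg hk.le, smul_eq_mul]

/-- If `H₂ᴴ·H₂ = c·I` with `c > 0`, then the largest eigenvalue of
`A = H₁ᴴ·H₂ᴴ·(a·H₂·H₂ᴴ + I)⁻¹·H₂·H₁` equals `(c/(a·c + 1))·λ_max(H₁ᴴ·H₁)`. -/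
theorem stmt5 {ns nr nd : ℕ} (H₁ : Matrix (Fin nr) (Fin ns) ℂ)
    (H₂ : Matrix (Fin nd) (Fin nr) ℂ) (a c : ℝ) (ha : 0 ≤ a) (hc : 0 < c)
    (hH₂ : H₂ᴴ * H₂ = (c : ℂ) • 1)
    (A : Matrix (Fin ns) (Fin ns) ℂ)
    (hA : A = H₁ᴴ * H₂ᴴ * ((a : ℂ) • (H₂ * H₂ᴴ) + 1)⁻¹ * H₂ * H₁) :
    ∀ (h1 : A.IsHermitian) (h2 : (H₁ᴴ * H₁).IsHermitian),
      (⨆ i, h1.eigenvalues i) = (c / (a * c + 1)) * ⨆ i, h2.eigenvalues i := by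
  intro h1 h2
  have hk : 0 < c / (a * c + 1) := by positivity
  have hA' : A = (c / (a * c + 1)) • (H₁ᴴ * H₁) := by
    have h := conjTranspose_mul_inv_mul_of_conjTranspose_mul_self H₂ ha hc hH₂
    rw [hA, Matrix.mul_assoc H₁ᴴ, Matrix.mul_assoc H₁ᴴ, h, Matrix.mul_smul, Matrix.mul_one,
      Matrix.smul_mul, Complex.coe_smul]
  rw [h1.iSup_eigenvalues_eq_sSup_spectrum, h2.iSup_eigenvalues_eq_sSup_spectrum, hA',
    spectrum.sSup_smul_of_pos _ hk]
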